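/- Let K be a nondegenerate n-simplex and k ≥ 2. The divergence operator maps the bubble space Σ_{K,k,b} onto R^⊥(K), the orthogonal complement of the rigid motion space R(K) within P_{k-1}(K; ℝⁿ) with respect to the L² inner product over K. That is, div Σ_{K,k,b} = R^⊥(K). -/

import Mathlib

open MvPolynomial MeasureTheory

/-- The derivative of a polynomial in the constant direction `t`. -/
noncomputable def dirDeriv {n : ℕ} (t : Fin n → ℝ) :
    Derivation ℝ (MvPolynomial (Fin n) ℝ) (MvPolynomial (Fin n) ℝ) :=
  ∑ b, t b • pderiv b

theorem dirDeriv_apply {n : ℕ} (t : Fin n → ℝ) (p : MvPolynomial (Fin n) ℝ) :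
    dirDeriv t p = ∑ b, C (t b) * pderiv b p := by
  have e : ∀ s : Finset (Fin n), (∑ b ∈ s, t b • pderiv b :
      Derivation ℝ (MvPolynomial (Fin n) ℝ) (MvPolynomial (Fin n) ℝ)) p =
      ∑ b ∈ s, C (t b) * pderiv b p := by
    intro s
    induction s using Finset.cons_induction with
    | empty => simp
    | cons a s ha ih =>
      rw [Finset.sum_cons, Finset.sum_cons, Derivation.add_apply, ih, Derivation.smul_apply,
        smul_eq_C_mul]
  exact e _

theorem hasDerivAt_eval_add_smul {n : ℕ} (y t : Fin n → ℝ) (p : MvPolynomial (Fin n) ℝ) (s : ℝ) :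
    HasDerivAt (fun s : ℝ => eval (y + s • t) p) (eval (y + s • t) (dirDeriv t p)) s := by
  induction p using MvPolynomial.induction_on with
  | C a => simpa [dirDeriv_apply] using hasDerivAt_const s a
  | add p q hp hq =>
    simp only [map_add]
    exact hp.add hq
  | mul_X p i hp =>
    have hX : HasDerivAt (fun s : ℝ => y i + s * t i) (t i) s := by
      simpa using ((hasDerivAt_id s).mul_const (t i)).const_add (y i)
    have hD : dirDeriv t (X i) = C (t i) := by
      simp [dirDeriv_apply, pderiv_X, Pi.single_apply]
    have h := hp.mul hX
    simp only [map_mul, eval_X, Pi.add_apply, Pi.smul_apply, smul_eq_mul, Derivation.leibniz, hD,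
      map_add, eval_C]
    refine h.congr_deriv ?_
    ring

theorem totalDegree_pderiv_le {σ R : Type*} [CommSemiring R] (i : σ) (p : MvPolynomial σ R) :
    (pderiv i p).totalDegree ≤ p.totalDegree - 1 := by
  refine Finset.sup_le fun m hm => ?_
  have hm' : m + Finsupp.single i 1 ∈ p.support := by
    rw [mem_support_iff] at hm ⊢
    rw [coeff_pderiv] at hm
    exact left_ne_zero_of_mul hm
  have h := le_totalDegree hm'
  rw [Finsupp.sum_add_index' (fun _ => rfl) (fun _ _ _ => rfl), Finsupp.sum_single_index rfl] at h
  omega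

theorem eq_C_of_pderiv_eq_zero {σ R : Type*} [CommRing R] [IsDomain R] [CharZero R]
    {p : MvPolynomial σ R} (h : ∀ i, pderiv i p = 0) : p = C (coeff 0 p) := by
  classical
  ext m
  rw [coeff_C]
  split_ifs with hm
  · rw [hm]
  obtain ⟨i, hi⟩ : ∃ i, m i ≠ 0 := by
    by_contra! hc
    exact hm (Finsupp.ext fun i => (hc i).symm)
  have h1 := congrArg (coeff (m - Finsupp.single i 1)) (h i)
  rw [coeff_pderiv, tsub_add_cancel_of_le (by simpa [Nat.one_le_iff_ne_zero] using hi),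
    coeff_zero] at h1
  exact (mul_eq_zero.1 h1).resolve_right (Nat.cast_add_one_ne_zero _)

theorem exists_affine_of_pderiv_pderiv_eq_zero {n : ℕ} {p : MvPolynomial (Fin n) ℝ} {b : Fin n → ℝ}
    (h : ∀ i, pderiv i p = C (b i)) : ∃ c : ℝ, p = C c + ∑ i, C (b i) * X i := by
  refine ⟨coeff 0 (p - ∑ i, C (b i) * X i), ?_⟩
  rw [← eq_C_of_pderiv_eq_zero, sub_add_cancel]
  intro i
  simp [h, pderiv_X, Pi.single_apply]

theorem exists_affine_of_totalDegree_le_one {n : ℕ} {p : MvPolynomial (Fin n) ℝ}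
    (h : p.totalDegree ≤ 1) : ∃ (c : ℝ) (b : Fin n → ℝ), p = C c + ∑ i, C (b i) * X i := by
  have h0 : ∀ i, pderiv i p = C (coeff 0 (pderiv i p)) := fun i =>
    totalDegree_eq_zero_iff_eq_C.1 (by have := totalDegree_pderiv_le i p; omega)
  obtain ⟨c, hc⟩ := exists_affine_of_pderiv_pderiv_eq_zero h0
  exact ⟨c, _, hc⟩

theorem eval_combo_of_totalDegree_le_one {n : ℕ} {p : MvPolynomial (Fin n) ℝ}
    (h : p.totalDegree ≤ 1) {α β : ℝ} (hαβ : α + β = 1) (y z : Fin n → ℝ) :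
    eval (α • y + β • z) p = α * eval y p + β * eval z p := by
  obtain ⟨c, b, rfl⟩ := exists_affine_of_totalDegree_le_one h
  simp only [map_add, map_sum, map_mul, eval_C, eval_X, Pi.add_apply, Pi.smul_apply, smul_eq_mul,
    mul_add, Finset.mul_sum, Finset.sum_add_distrib]
  have e : ∀ (γ : ℝ) (u : Fin n → ℝ), ∑ i, b i * (γ * u i) = ∑ i, γ * (b i * u i) := fun γ u =>
    Finset.sum_congr rfl fun i _ => by ring
  rw [e, e]
  linear_combination (-c) * hαβ

theorem eval_add_smul_sub_of_totalDegree_le_one {n : ℕ} {p : MvPolynomial (Fin n) ℝ}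
    (h : p.totalDegree ≤ 1) (y u w : Fin n → ℝ) (s : ℝ) :
    eval (y + s • (u - w)) p = eval y p + s * (eval u p - eval w p) := by
  obtain ⟨c, b, rfl⟩ := exists_affine_of_totalDegree_le_one h
  simp only [map_add, map_sum, map_mul, eval_C, eval_X, Pi.add_apply, Pi.smul_apply, Pi.sub_apply,
    smul_eq_mul, add_sub_add_left_eq_sub, ← Finset.sum_sub_distrib, Finset.mul_sum, add_assoc,
    ← Finset.sum_add_distrib]
  congr 1
  exact Finset.sum_congr rfl fun i _ => by ring

/-- A polynomial vector field with vanishing symmetric gradient is a rigid motion. -/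
theorem exists_rigid_of_symm_grad_eq_zero {n : ℕ} {v : Fin n → MvPolynomial (Fin n) ℝ}
    (h : ∀ i j, pderiv i (v j) + pderiv j (v i) = 0) :
    ∃ (a : Fin n → ℝ) (B : Matrix (Fin n) (Fin n) ℝ), B.transpose = -B ∧
      ∀ i, v i = C (a i) + ∑ j, C (B i j) * X j := by
  have hcomm : ∀ i j (p : MvPolynomial (Fin n) ℝ),
      pderiv i (pderiv j p) = pderiv j (pderiv i p) := by
    intro i j p
    ext m
    simp only [coeff_pderiv]
    rw [add_right_comm]
    rcases eq_or_ne i j with rfl | hij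
    · rfl
    · simp [hij, hij.symm]
      ring
  have hsecond : ∀ i j l, pderiv i (pderiv j (v l)) = 0 := by
    intro i j l
    have e : ∀ a b c, pderiv a (pderiv b (v c)) = - pderiv a (pderiv c (v b)) := fun a b c => by
      rw [eq_neg_of_add_eq_zero_left (h b c), map_neg]
    have e' : pderiv i (pderiv j (v l)) = -pderiv i (pderiv j (v l)) := by
      calc pderiv i (pderiv j (v l)) = -pderiv i (pderiv l (v j)) := e _ _ _
        _ = -pderiv l (pderiv i (v j)) := by rw [hcomm]
        _ = pderiv l (pderiv j (v i)) := by rw [e, neg_neg]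
        _ = pderiv j (pderiv l (v i)) := hcomm _ _ _
        _ = -pderiv j (pderiv i (v l)) := e _ _ _
        _ = -pderiv i (pderiv j (v l)) := by rw [hcomm]
    exact self_eq_neg.1 e'
  have hconst : ∀ j l, pderiv j (v l) = C (coeff 0 (pderiv j (v l))) := fun j l =>
    eq_C_of_pderiv_eq_zero fun i => hsecond i j l
  choose a ha using fun l => exists_affine_of_pderiv_pderiv_eq_zero fun j => hconst j l
  refine ⟨a, Matrix.of fun l j => coeff 0 (pderiv j (v l)), ?_, ha⟩
  ext i j
  simpa [eq_neg_iff_add_eq_zero] using congrArg (coeff 0) (h i j)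

theorem eq_zero_of_eval_eq_zero_of_nonempty_interior {n : ℕ} {p : MvPolynomial (Fin n) ℝ}
    {s : Set (Fin n → ℝ)} (hs : (interior s).Nonempty) (h : ∀ y ∈ interior s, eval y p = 0) :
    p = 0 := by
  obtain ⟨y, hy⟩ := hs
  obtain ⟨ε, hε, hb⟩ := Metric.isOpen_iff.1 isOpen_interior y hy
  refine funext_set (fun i => Metric.ball (y i) ε) (fun i => ?_) fun z hz => ?_
  · rw [Real.ball_eq_Ioo]; exact Set.Ioo_infinite (by linarith)
  · rw [h z (hb ?_), map_zero]
    rwa [ball_pi _ hε]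

theorem eq_zero_of_dot_eq_zero {n : ℕ} {e : Fin n → (Fin n → ℝ)} (he : LinearIndependent ℝ e)
    {b : Fin n → ℝ} (h : ∀ i, ∑ a, e i a * b a = 0) : b = 0 := by
  have : IsUnit (Matrix.of e) := Matrix.linearIndependent_rows_iff_isUnit.1 he
  exact Matrix.mulVec_injective_iff_isUnit.2 this
    (by ext i; simpa [Matrix.mulVec, dotProduct] using h i)

/-- A finite-dimensional subspace on which a bilinear form is anisotropic has orthogonal
projections. -/
theorem exists_mem_forall_sub_orthogonal {V : Type*} [AddCommGroup V] [Module ℝ V]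
    (B : LinearMap.BilinForm ℝ V) (W : Submodule ℝ V) [FiniteDimensional ℝ W]
    (h : ∀ w ∈ W, B w w = 0 → w = 0) (v : V) : ∃ w ∈ W, ∀ u ∈ W, B (v - w) u = 0 := by
  let Φ : W →ₗ[ℝ] Module.Dual ℝ W := B.restrict W
  have hinj : Function.Injective Φ := by
    rw [injective_iff_map_eq_zero]
    intro w hw
    exact Subtype.ext (h w w.2 (by simpa [Φ] using LinearMap.congr_fun hw w))
  have hsurj : Function.Surjective Φ :=
    (LinearMap.injective_iff_surjective_of_finrank_eq_finrank
      (Subspace.dual_finrank_eq (K := ℝ) (V := W)).symm).1 hinj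
  obtain ⟨w, hw⟩ := hsurj ((B v).comp W.subtype)
  refine ⟨w, w.2, fun u hu => ?_⟩
  have := LinearMap.congr_fun hw ⟨u, hu⟩
  simp [Φ] at this
  simp [this]

/-- Directional derivatives integrate to zero over a compact convex set when the extension of the
function by zero is Lipschitz in that direction. -/
theorem setIntegral_eq_zero_of_hasDerivAt {E : Type*} [NormedAddCommGroup E] [NormedSpace ℝ E]
    [FiniteDimensional ℝ E] [MeasurableSpace E] [BorelSpace E] (μ : Measure E) [μ.IsAddHaarMeasure]
    {K : Set E} (hK : IsCompact K) (hKc : Convex ℝ K) {f g : E → ℝ} (t : E)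
    (hf : Continuous f) (hg : Continuous g)
    (hfg : ∀ y, HasDerivAt (fun s : ℝ => f (y + s • t)) (g y) 0) {M : ℝ}
    (hlip : ∀ (z : E) (s : ℝ), |K.indicator f (z + s • t) - K.indicator f z| ≤ M * |s|) :
    ∫ y in K, g y ∂μ = 0 := by
  have hM : 0 ≤ M := by simpa using (abs_nonneg _).trans (hlip 0 1)
  set F : ℝ → E → ℝ := fun s y => K.indicator f (y + s • t) with hF
  set K' : Set E := (fun p : ℝ × E => p.2 - p.1 • t) '' (Set.Icc (-1) 1 ×ˢ K) with hK'
  have hK'c : IsCompact K' := (isCompact_Icc.prod hK).image (by fun_prop)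
  have hmem : ∀ s ∈ Set.Ioo (-1 : ℝ) 1, ∀ y, y ∉ K' → F s y = 0 := by
    intro s hs y hy
    refine Set.indicator_of_notMem (fun h => hy ?_) _
    exact ⟨(s, y + s • t), ⟨Set.Ioo_subset_Icc_self hs, h⟩, by simp⟩
  have hmeas : Measurable (K.indicator f) := hf.measurable.indicator hK.isClosed.measurableSet
  have hint : Integrable (K.indicator f) μ :=
    (hf.continuousOn.integrableOn_compact hK).integrable_indicator hK.isClosed.measurableSet
  have key := hasDerivAt_integral_of_dominated_loc_of_lip (μ := μ) (F := F) (x₀ := (0 : ℝ))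
    (F' := K.indicator g) (bound := K'.indicator fun _ => M)
    (s := Set.Ioo (-1) 1) (Ioo_mem_nhds (by norm_num) (by norm_num))
    (Filter.Eventually.of_forall fun s =>
      (hmeas.comp (measurable_id.add_const _)).aestronglyMeasurable)
    (by simpa [hF] using hint)
    (hg.measurable.indicator hK.isClosed.measurableSet).aestronglyMeasurable
    (Filter.Eventually.of_forall fun y => by
      refine LipschitzOnWith.of_dist_le_mul fun s hs s' hs' => ?_
      by_cases hy : y ∈ K'
      · have := hlip (y + s' • t) (s - s')
        rw [add_assoc, ← add_smul, add_sub_cancel] at this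
        simpa [hy, Real.dist_eq, abs_of_nonneg hM] using this
      · simp [hy, hmem s hs y hy, hmem s' hs' y hy])
    ((continuousOn_const.integrableOn_compact hK'c).integrable_indicator
      hK'c.isClosed.measurableSet)
    (by
      have hfr : ∀ᵐ y ∂μ, y ∉ frontier K := measure_eq_zero_iff_ae_notMem.1 (hKc.addHaar_frontier μ)
      filter_upwards [hfr] with y hy
      have hcont : Filter.Tendsto (fun s : ℝ => y + s • t) (nhds 0) (nhds y) := by
        have : Continuous fun s : ℝ => y + s • t := by fun_prop
        simpa using this.tendsto 0
      by_cases hyK : y ∈ K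
      · have hyi : y ∈ interior K := by
          by_contra h
          exact hy ⟨subset_closure hyK, h⟩
        rw [Set.indicator_of_mem hyK]
        refine (hfg y).congr_of_eventuallyEq ?_
        filter_upwards [hcont (isOpen_interior.mem_nhds hyi)] with s hs
        exact Set.indicator_of_mem (interior_subset hs) _
      · rw [Set.indicator_of_notMem hyK]
        refine (hasDerivAt_const (0 : ℝ) (0 : ℝ)).congr_of_eventuallyEq ?_
        filter_upwards [hcont (hK.isClosed.isOpen_compl.mem_nhds hyK)] with s hs
        exact Set.indicator_of_notMem hs _)
  have hconst : ∀ s, ∫ y, F s y ∂μ = ∫ y, K.indicator f y ∂μ := fun s =>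
    integral_add_right_eq_self (K.indicator f) (s • t)
  simp only [hconst] at key
  rw [← integral_indicator hK.isClosed.measurableSet]
  exact key.2.unique (hasDerivAt_const _ _)

section Simplex

variable {n : ℕ} {x : Fin (n + 1) → (Fin n → ℝ)} {lamp : Fin (n + 1) → MvPolynomial (Fin n) ℝ}

theorem eq_zero_of_eval_vertices_eq_zero
    (hx : LinearIndependent ℝ (fun i : Fin n => x i.succ - x 0))
    {p : MvPolynomial (Fin n) ℝ} (hp : p.totalDegree ≤ 1) (h : ∀ j, eval (x j) p = 0) : p = 0 := by
  obtain ⟨c, b, rfl⟩ := exists_affine_of_totalDegree_le_one hp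
  have hb : b = 0 := by
    refine eq_zero_of_dot_eq_zero hx fun i => ?_
    have e := congrArg₂ (· - ·) (h i.succ) (h 0)
    simp only [map_add, map_sum, map_mul, eval_C, eval_X, add_sub_add_left_eq_sub,
      ← Finset.sum_sub_distrib, sub_zero] at e
    rw [← e]
    exact Finset.sum_congr rfl fun a _ => by simp; ring
  have hc := h 0
  simp [hb] at hc
  simp [hb, hc]

theorem convexHull_eq_setOf_eval_nonneg
    (hx : LinearIndependent ℝ (fun i : Fin n => x i.succ - x 0))
    (hlam_deg : ∀ i, (lamp i).totalDegree ≤ 1)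
    (hlam_bary : ∀ i j, eval (x j) (lamp i) = if i = j then 1 else 0)
    (hlam_sum : ∑ i : Fin (n + 1), lamp i = 1) :
    convexHull ℝ (Set.range x) = {y | ∀ l, 0 ≤ eval y (lamp l)} := by
  apply Set.Subset.antisymm
  · refine convexHull_min ?_ ?_
    · rintro _ ⟨j, rfl⟩ l
      rw [hlam_bary]
      split_ifs <;> norm_num
    · intro u hu w hw α β hα hβ hαβ l
      rw [eval_combo_of_totalDegree_le_one (hlam_deg l) hαβ]
      have := hu l
      have := hw l
      positivity
  · intro y hy
    have hrepr : ∀ a, ∑ l, lamp l * C (x l a) - X a = 0 := by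
      refine fun a => eq_zero_of_eval_vertices_eq_zero hx ?_ fun j => ?_
      · refine (totalDegree_sub _ _).trans (max_le ?_ (totalDegree_X a).le)
        refine (totalDegree_finsetSum _ _).trans (Finset.sup_le fun l _ => ?_)
        exact (totalDegree_mul _ _).trans (by simpa using hlam_deg l)
      · simp [hlam_bary]
    have hy' : y = ∑ l, eval y (lamp l) • x l := by
      ext a
      have := congrArg (eval y) (hrepr a)
      simp [sub_eq_zero] at this
      simp [this]
    rw [hy']
    refine (convex_convexHull ℝ _).sum_mem (fun l _ => hy l) ?_
      fun l _ => subset_convexHull ℝ _ ⟨l, rfl⟩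
    simpa using congrArg (eval y) hlam_sum

theorem isCompact_convexHull_range (x : Fin (n + 1) → (Fin n → ℝ)) :
    IsCompact (convexHull ℝ (Set.range x)) :=
  (Set.finite_range x).isCompact_convexHull (𝕜 := ℝ)

theorem interior_convexHull_range_nonempty
    (hx : LinearIndependent ℝ (fun i : Fin n => x i.succ - x 0)) :
    (interior (convexHull ℝ (Set.range x))).Nonempty := by
  rw [interior_convexHull_nonempty_iff_affineSpan_eq_top]
  have hai : AffineIndependent ℝ x := by
    rw [affineIndependent_iff_linearIndependent_vsub ℝ x 0]
    have h : LinearIndependent ℝ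
        ((fun i : {l : Fin (n + 1) // l ≠ 0} => x i -ᵥ x 0) ∘
          finSuccAboveEquiv (0 : Fin (n + 1))) := by
      simpa [Function.comp_def, finSuccAboveEquiv_apply] using hx
    exact (linearIndependent_equiv _).1 h
  exact hai.affineSpan_eq_top_iff_card_eq_finrank_add_one.2 (by simp)

/-- Along the edge from `x i` to `x j`, the derivative of a polynomial divisible by the barycentric
coordinates of both endpoints integrates to zero. -/
theorem setIntegral_dirDeriv_edge_eq_zero
    (hx : LinearIndependent ℝ (fun i : Fin n => x i.succ - x 0))
    (hlam_deg : ∀ i, (lamp i).totalDegree ≤ 1)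
    (hlam_bary : ∀ i j, eval (x j) (lamp i) = if i = j then 1 else 0)
    (hlam_sum : ∑ i : Fin (n + 1), lamp i = 1) (i j : Fin (n + 1)) (p : MvPolynomial (Fin n) ℝ) :
    ∫ y in convexHull ℝ (Set.range x), eval y (dirDeriv (x j - x i) (lamp i * lamp j * p)) = 0 := by
  set K := convexHull ℝ (Set.range x) with hK
  set t := x j - x i with ht
  have hKeq : ∀ y, y ∈ K ↔ ∀ l, 0 ≤ eval y (lamp l) := fun y => by
    rw [hK, convexHull_eq_setOf_eval_nonneg hx hlam_deg hlam_bary hlam_sum]; rfl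
  have hKc : IsCompact K := isCompact_convexHull_range x
  have hKv : Convex ℝ K := convex_convexHull ℝ _
  have hbdd : ∀ q : MvPolynomial (Fin n) ℝ, ∃ M, 0 ≤ M ∧ ∀ y ∈ K, |eval y q| ≤ M := fun q => by
    obtain ⟨M, hM⟩ := hKc.exists_bound_of_continuousOn (f := fun y => eval y q)
      (MvPolynomial.continuous_eval q).continuousOn
    exact ⟨max M 0, le_max_right _ _, fun y hy => (hM y hy).trans (le_max_left _ _)⟩
  set f := lamp i * lamp j * p with hf
  obtain ⟨M₁, hM₁, hb₁⟩ := hbdd (dirDeriv t f)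
  obtain ⟨M₂, hM₂, hb₂⟩ := hbdd (lamp i * p)
  obtain ⟨M₃, hM₃, hb₃⟩ := hbdd (lamp j * p)
  have hlamt : ∀ l y (s : ℝ), eval (y + s • t) (lamp l) =
      eval y (lamp l) + s * ((if l = j then 1 else 0) - if l = i then 1 else 0) := fun l y s => by
    rw [eval_add_smul_sub_of_totalDegree_le_one (hlam_deg l), hlam_bary, hlam_bary]
  have hin : ∀ z (s : ℝ), z ∈ K → z + s • t ∈ K →
      |eval (z + s • t) f - eval z f| ≤ M₁ * |s| := by
    intro z s hz hzs
    have h := Convex.norm_image_sub_le_of_norm_hasDerivWithin_le (𝕜 := ℝ)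
      (f := fun r : ℝ => eval (z + r • (s • t)) f)
      (f' := fun r => s * eval (z + (r * s) • t) (dirDeriv t f))
      (s := Set.Icc 0 1) (x := 0) (y := 1) (C := M₁ * |s|)
      (fun r hr => by
        have h1 := (hasDerivAt_eval_add_smul z t f (r * s)).scomp r (hasDerivAt_mul_const s)
        simpa [Function.comp_def, mul_smul] using h1.hasDerivWithinAt)
      (fun r hr => by
        rw [norm_mul, mul_comm, Real.norm_eq_abs, Real.norm_eq_abs]
        refine mul_le_mul_of_nonneg_right (hb₁ _ ?_) (abs_nonneg _)
        rw [mul_smul]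
        have := hKv.add_smul_sub_mem hz hzs hr
        simpa using this)
      (convex_Icc 0 1) (by simp) (by simp)
    simpa using h
  have hout : ∀ z (s : ℝ), z ∈ K → z + s • t ∉ K → |eval z f| ≤ (M₂ + M₃) * |s| := by
    intro z s hz hzs
    rw [hKeq] at hzs
    push Not at hzs
    obtain ⟨l, hl⟩ := hzs
    have hzl := (hKeq z).1 hz
    rw [hlamt] at hl
    have h0 := hzl l
    rcases eq_or_ne l i with rfl | hli
    · have hs : eval z (lamp l) ≤ |s| := by
        split_ifs at hl <;> nlinarith [le_abs_self s, neg_abs_le s]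
      have e : f = lamp l * (lamp j * p) := by rw [hf]; ring
      rw [e, map_mul, abs_mul, abs_of_nonneg h0]
      nlinarith [hb₃ z hz, abs_nonneg (eval z (lamp j * p)), abs_nonneg s,
        mul_le_mul hs (hb₃ z hz) (abs_nonneg _) (abs_nonneg s), mul_nonneg hM₂ (abs_nonneg s)]
    rcases eq_or_ne l j with rfl | hlj
    · have hs : eval z (lamp l) ≤ |s| := by
        split_ifs at hl <;> nlinarith [le_abs_self s, neg_abs_le s]
      have e : f = lamp l * (lamp i * p) := by rw [hf]; ring
      rw [e, map_mul, abs_mul, abs_of_nonneg h0]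
      nlinarith [mul_le_mul hs (hb₂ z hz) (abs_nonneg _) (abs_nonneg s),
        mul_nonneg hM₃ (abs_nonneg s)]
    · simp [hli, hlj] at hl
      linarith
  refine setIntegral_eq_zero_of_hasDerivAt volume hKc hKv t (f := fun y => eval y f)
    (M := M₁ + (M₂ + M₃)) (MvPolynomial.continuous_eval _) (MvPolynomial.continuous_eval _)
    (fun y => by simpa using hasDerivAt_eval_add_smul y t f 0) fun z s => ?_
  have hp₁ := mul_nonneg hM₁ (abs_nonneg s)
  have hp₂ := mul_nonneg (add_nonneg hM₂ hM₃) (abs_nonneg s)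
  rw [add_mul]
  by_cases hz : z ∈ K <;> by_cases hzs : z + s • t ∈ K
  · rw [Set.indicator_of_mem hz, Set.indicator_of_mem hzs]
    linarith [hin z s hz hzs]
  · rw [Set.indicator_of_mem hz, Set.indicator_of_notMem hzs, zero_sub, abs_neg]
    linarith [hout z s hz hzs]
  · rw [Set.indicator_of_notMem hz, Set.indicator_of_mem hzs, sub_zero]
    have := hout (z + s • t) (-s) hzs (by simpa using hz)
    rw [abs_neg] at this
    linarith
  · rw [Set.indicator_of_notMem hz, Set.indicator_of_notMem hzs, sub_zero, abs_zero]
    linarith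

end Simplex

/-- Integration of polynomials over a compact set, as a linear functional. -/
noncomputable def integralOn {n : ℕ} {K : Set (Fin n → ℝ)} (hK : IsCompact K) :
    MvPolynomial (Fin n) ℝ →ₗ[ℝ] ℝ where
  toFun p := ∫ y in K, eval y p
  map_add' p q := by
    simp only [map_add]
    exact integral_add ((MvPolynomial.continuous_eval p).continuousOn.integrableOn_compact hK)
      ((MvPolynomial.continuous_eval q).continuousOn.integrableOn_compact hK)
  map_smul' c p := by
    simp only [smul_eval, RingHom.id_apply, smul_eq_mul]
    exact integral_const_mul c _

theorem eq_zero_of_integralOn_eq_zero {n : ℕ} {K : Set (Fin n → ℝ)} (hK : IsCompact K)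
    (hKi : (interior K).Nonempty) {p : MvPolynomial (Fin n) ℝ} (hp : ∀ y ∈ K, 0 ≤ eval y p)
    (h : integralOn hK p = 0) : p = 0 := by
  refine eq_zero_of_eval_eq_zero_of_nonempty_interior hKi fun y hy => ?_
  have hc := MvPolynomial.continuous_eval p
  have hae : (fun y => eval y p) =ᵐ[volume.restrict K] 0 :=
    (setIntegral_eq_zero_iff_of_nonneg_ae
      (ae_restrict_of_forall_mem hK.isClosed.measurableSet hp)
      (hc.continuousOn.integrableOn_compact hK)).1 h
  have hae' : (fun y => eval y p) =ᵐ[volume.restrict (interior K)] fun _ => 0 :=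
    ae_mono (Measure.restrict_mono interior_subset le_rfl) hae
  exact Measure.eqOn_open_of_ae_eq hae' isOpen_interior hc.continuousOn continuousOn_const hy

/-- The `L²` inner product of polynomial vector fields over a compact set. -/
noncomputable def l2Form {n : ℕ} {K : Set (Fin n → ℝ)} (hK : IsCompact K) :
    LinearMap.BilinForm ℝ (Fin n → MvPolynomial (Fin n) ℝ) :=
  LinearMap.mk₂ ℝ (fun u v => integralOn hK (∑ i, u i * v i))
    (fun u u' v => by simp [add_mul, Finset.sum_add_distrib])
    (fun c u v => by simp [← Finset.smul_sum])
    (fun u v v' => by simp [mul_add, Finset.sum_add_distrib])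
    (fun c u v => by simp [← Finset.smul_sum])

theorem l2Form_apply {n : ℕ} {K : Set (Fin n → ℝ)} (hK : IsCompact K)
    (u v : Fin n → MvPolynomial (Fin n) ℝ) : l2Form hK u v = integralOn hK (∑ i, u i * v i) := rfl

theorem l2Form_comm {n : ℕ} {K : Set (Fin n → ℝ)} (hK : IsCompact K)
    (u v : Fin n → MvPolynomial (Fin n) ℝ) : l2Form hK u v = l2Form hK v u := by
  simp only [l2Form_apply, mul_comm]

theorem eq_zero_of_l2Form_self_eq_zero {n : ℕ} {K : Set (Fin n → ℝ)} (hK : IsCompact K)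
    (hKi : (interior K).Nonempty) {v : Fin n → MvPolynomial (Fin n) ℝ}
    (h : l2Form hK v v = 0) : v = 0 := by
  have h0 : ∑ i, v i * v i = 0 := by
    refine eq_zero_of_integralOn_eq_zero hK hKi (fun y _ => ?_) h
    simp only [map_sum, map_mul]
    exact Finset.sum_nonneg fun i _ => mul_self_nonneg _
  ext1 i
  refine MvPolynomial.funext fun y => ?_
  have hy := congrArg (eval y) h0
  simp only [map_sum, map_mul, map_zero] at hy
  rw [Finset.sum_eq_zero_iff_of_nonneg fun i _ => mul_self_nonneg _] at hy
  simpa using hy i (Finset.mem_univ _)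

/-- The row-wise divergence of a polynomial matrix field. -/
noncomputable def matrixDiv (n : ℕ) : Matrix (Fin n) (Fin n) (MvPolynomial (Fin n) ℝ) →ₗ[ℝ]
    (Fin n → MvPolynomial (Fin n) ℝ) where
  toFun M i := ∑ j, pderiv j (M i j)
  map_add' M N := by ext1 i; simp [Finset.sum_add_distrib]
  map_smul' c M := by ext1 i; simp [Finset.smul_sum]

/-- The matrix field `g t tᵀ`. -/
noncomputable def rankOneField {n : ℕ} (g : MvPolynomial (Fin n) ℝ) (t : Fin n → ℝ) :
    Matrix (Fin n) (Fin n) (MvPolynomial (Fin n) ℝ) :=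
  Matrix.of fun a b => g * C (t a * t b)

/-- The component `tᵀ ε(v) t` of the symmetric gradient of `v`. -/
noncomputable def strainAlong {n : ℕ} (t : Fin n → ℝ) (v : Fin n → MvPolynomial (Fin n) ℝ) :
    MvPolynomial (Fin n) ℝ :=
  ∑ a, C (t a) * dirDeriv t (v a)

theorem matrixDiv_rankOneField {n : ℕ} (g : MvPolynomial (Fin n) ℝ) (t : Fin n → ℝ) (a : Fin n) :
    matrixDiv n (rankOneField g t) a = C (t a) * dirDeriv t g := by
  simp only [matrixDiv, rankOneField, LinearMap.coe_mk, AddHom.coe_mk, Matrix.of_apply,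
    dirDeriv_apply, Finset.mul_sum, mul_comm g, pderiv_C_mul, C_mul, mul_assoc]

theorem sum_matrixDiv_rankOneField_mul {n : ℕ} (g : MvPolynomial (Fin n) ℝ) (t : Fin n → ℝ)
    (v : Fin n → MvPolynomial (Fin n) ℝ) :
    ∑ a, matrixDiv n (rankOneField g t) a * v a =
      dirDeriv t (g * ∑ a, C (t a) * v a) - g * strainAlong t v := by
  have hC : ∀ c : ℝ, dirDeriv t (C c) = 0 := fun c => by simp
  simp only [matrixDiv_rankOneField, strainAlong, Derivation.leibniz, map_sum, smul_eq_mul, hC,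
    mul_zero, add_zero, add_sub_cancel_left, Finset.sum_mul]
  exact Finset.sum_congr rfl fun a _ => by ring

theorem totalDegree_dirDeriv_le {n : ℕ} (t : Fin n → ℝ) (p : MvPolynomial (Fin n) ℝ) :
    (dirDeriv t p).totalDegree ≤ p.totalDegree - 1 := by
  rw [dirDeriv_apply]
  refine (totalDegree_finsetSum _ _).trans (Finset.sup_le fun b _ => ?_)
  exact (totalDegree_mul _ _).trans (by simpa using totalDegree_pderiv_le b p)

theorem totalDegree_strainAlong_le {n d : ℕ} (t : Fin n → ℝ) {v : Fin n → MvPolynomial (Fin n) ℝ}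
    (hv : ∀ a, (v a).totalDegree ≤ d) : (strainAlong t v).totalDegree ≤ d - 1 := by
  refine (totalDegree_finsetSum _ _).trans (Finset.sup_le fun a _ => ?_)
  have h₁ := totalDegree_mul (C (t a)) (dirDeriv t (v a))
  have h₂ := totalDegree_dirDeriv_le t (v a)
  have h₃ := hv a
  simp only [totalDegree_C] at h₁
  omega

/-- The polynomial vector field `y ↦ a + B y`. -/
noncomputable def affineField {n : ℕ} (a : Fin n → ℝ) (B : Matrix (Fin n) (Fin n) ℝ) (i : Fin n) :
    MvPolynomial (Fin n) ℝ :=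
  C (a i) + ∑ j, C (B i j) * X j

theorem eval_affineField {n : ℕ} (a : Fin n → ℝ) (B : Matrix (Fin n) (Fin n) ℝ) (i : Fin n)
    (y : Fin n → ℝ) : eval y (affineField a B i) = a i + B.mulVec y i := by
  simp [affineField, Matrix.mulVec, dotProduct]

theorem strainAlong_affineField {n : ℕ} (t a : Fin n → ℝ) {B : Matrix (Fin n) (Fin n) ℝ}
    (hB : B.transpose = -B) : strainAlong t (affineField a B) = 0 := by
  have hd : ∀ i, dirDeriv t (affineField a B i) = C (B.mulVec t i) := fun i => by
    simp [dirDeriv_apply, affineField, pderiv_X, Pi.single_apply, Matrix.mulVec, dotProduct,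
      mul_comm]
  have h0 : t ⬝ᵥ B.mulVec t = 0 := by
    have h : t ⬝ᵥ B.mulVec t = -(t ⬝ᵥ B.mulVec t) := by
      conv_lhs => rw [Matrix.dotProduct_mulVec, ← Matrix.mulVec_transpose, hB, Matrix.neg_mulVec,
        neg_dotProduct, dotProduct_comm]
    exact self_eq_neg.1 h
  simp only [strainAlong, hd, ← C_mul, ← map_sum]
  rw [← C_0, ← h0, dotProduct]

/-- The symmetric gradient is determined by its components along the edges of a simplex. -/
theorem symm_grad_eq_zero_of_strainAlong_edges {n : ℕ} {x : Fin (n + 1) → (Fin n → ℝ)}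
    (hx : LinearIndependent ℝ (fun i : Fin n => x i.succ - x 0))
    {v : Fin n → MvPolynomial (Fin n) ℝ} (h : ∀ i j, strainAlong (x j - x i) v = 0) (a b : Fin n) :
    pderiv a (v b) + pderiv b (v a) = 0 := by
  refine MvPolynomial.funext fun y => ?_
  let S : Matrix (Fin n) (Fin n) ℝ :=
    Matrix.of fun a b => eval y (pderiv a (v b)) + eval y (pderiv b (v a))
  have hST : S.transpose = S := by
    ext a b
    exact add_comm _ _
  have hq : ∀ t, t ⬝ᵥ S.mulVec t = 2 * eval y (strainAlong t v) := by
    intro t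
    have e₁ : eval y (strainAlong t v) = ∑ a, ∑ b, t a * t b * eval y (pderiv b (v a)) := by
      simp [strainAlong, dirDeriv_apply, Finset.mul_sum, mul_assoc]
    have e₂ : eval y (strainAlong t v) = ∑ a, ∑ b, t a * t b * eval y (pderiv a (v b)) := by
      rw [e₁, Finset.sum_comm]
      simp only [mul_comm (t _) (t _)]
    rw [two_mul]
    nth_rewrite 1 [e₂]
    rw [e₁]
    simp only [dotProduct, Matrix.mulVec, Finset.mul_sum, ← Finset.sum_add_distrib]
    exact Finset.sum_congr rfl fun a _ => Finset.sum_congr rfl fun b _ => by simp [S]; ring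
  have hq0 : ∀ i j, (x j - x i) ⬝ᵥ S.mulVec (x j - x i) = 0 := fun i j => by simp [hq, h]
  set e : Fin n → Fin n → ℝ := fun i => x i.succ - x 0 with he
  have hsymm : ∀ u w, u ⬝ᵥ S.mulVec w = w ⬝ᵥ S.mulVec u := fun u w => by
    conv_lhs => rw [Matrix.dotProduct_mulVec, ← Matrix.mulVec_transpose, hST, dotProduct_comm]
  have hpol : ∀ i j, e i ⬝ᵥ S.mulVec (e j) = 0 := by
    intro i j
    have h₁ := hq0 0 i.succ
    have h₂ := hq0 0 j.succ
    have h₃ := hq0 j.succ i.succ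
    have hd : x i.succ - x j.succ = e i - e j := by simp [he]
    rw [hd, Matrix.mulVec_sub, sub_dotProduct, dotProduct_sub, dotProduct_sub,
      hsymm (e j) (e i)] at h₃
    change e i ⬝ᵥ S.mulVec (e i) = 0 at h₁
    change e j ⬝ᵥ S.mulVec (e j) = 0 at h₂
    linarith
  have hcol : ∀ j, S.mulVec (e j) = 0 := fun j => eq_zero_of_dot_eq_zero hx fun i => hpol i j
  have hrow : ∀ a, S a = 0 := fun a => eq_zero_of_dot_eq_zero hx fun j => by
    have := congrFun (hcol j) a
    rw [Matrix.mulVec, dotProduct_comm] at this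
    exact this
  simpa [S] using congrFun (hrow a) b

/-- Green's formula for the generators of the bubble space. -/
theorem l2Form_matrixDiv_rankOneField {n : ℕ} {x : Fin (n + 1) → (Fin n → ℝ)}
    {lamp : Fin (n + 1) → MvPolynomial (Fin n) ℝ}
    (hx : LinearIndependent ℝ (fun i : Fin n => x i.succ - x 0))
    (hlam_deg : ∀ i, (lamp i).totalDegree ≤ 1)
    (hlam_bary : ∀ i j, eval (x j) (lamp i) = if i = j then 1 else 0)
    (hlam_sum : ∑ i : Fin (n + 1), lamp i = 1) (i j : Fin (n + 1)) (q : MvPolynomial (Fin n) ℝ)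
    (v : Fin n → MvPolynomial (Fin n) ℝ) :
    l2Form (isCompact_convexHull_range x)
      (matrixDiv n (rankOneField (lamp i * lamp j * q) (x j - x i))) v =
    -integralOn (isCompact_convexHull_range x)
      (lamp i * lamp j * q * strainAlong (x j - x i) v) := by
  rw [l2Form_apply, sum_matrixDiv_rankOneField_mul, map_sub, mul_assoc (lamp i * lamp j) q (∑ a, _)]
  have h := setIntegral_dirDeriv_edge_eq_zero hx hlam_deg hlam_bary hlam_sum i j
    (q * ∑ a, C ((x j - x i) a) * v a)
  rw [sub_eq_neg_self]
  exact h

theorem finiteDimensional_of_totalDegree_le {n d : ℕ}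
    {W : Submodule ℝ (Fin n → MvPolynomial (Fin n) ℝ)}
    (hW : ∀ v ∈ W, ∀ i, (v i).totalDegree ≤ d) : FiniteDimensional ℝ W := by
  let φ : W →ₗ[ℝ] (Fin n → restrictTotalDegree (Fin n) ℝ d) :=
    LinearMap.pi fun i => ((LinearMap.proj i).comp W.subtype).codRestrict _ fun v =>
      (mem_restrictTotalDegree _ _ _).2 (hW v v.2 i)
  refine FiniteDimensional.of_injective φ fun u v huv => Subtype.ext (_root_.funext fun i => ?_)
  exact congrArg Subtype.val (congrFun huv i)

/-- On a nondegenerate `n`-simplex `K` (here `K = conv{x₀,…,xₙ}`), for `k ≥ 2`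
the divergence operator maps the bubble space
`Σ_{K,k,b} = ∑_{i,j} λᵢλⱼ P_{k-2}(K;ℝ) T_{i,j}` onto `R^⊥(K)`, the orthogonal
complement of the rigid motion space inside `P_{k-1}(K;ℝⁿ)` with respect to the
`L²(K)` inner product. -/
theorem div_bubble_space_eq_rigid_orthogonal (n k : ℕ) (hn : 1 ≤ n) (hk : 2 ≤ k)
    (x : Fin (n + 1) → (Fin n → ℝ))
    (hx : LinearIndependent ℝ (fun i : Fin n => x i.succ - x 0))
    (lamp : Fin (n + 1) → MvPolynomial (Fin n) ℝ)
    (hlam_deg : ∀ i, (lamp i).totalDegree ≤ 1)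
    (hlam_bary : ∀ i j, MvPolynomial.eval (x j) (lamp i) = if i = j then 1 else 0)
    (hlam_sum : ∑ i : Fin (n + 1), lamp i = 1) :
    (fun M : Matrix (Fin n) (Fin n) (MvPolynomial (Fin n) ℝ) =>
        fun i : Fin n => ∑ j : Fin n, MvPolynomial.pderiv j (M i j)) ''
      (Submodule.span ℝ
        {M : Matrix (Fin n) (Fin n) (MvPolynomial (Fin n) ℝ) |
          ∃ (i j : Fin (n + 1)) (q : MvPolynomial (Fin n) ℝ), q.totalDegree ≤ k - 2 ∧
            M = Matrix.of fun a b => lamp i * lamp j * q *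
              MvPolynomial.C ((x j a - x i a) * (x j b - x i b))} : Set _)
    = {v : Fin n → MvPolynomial (Fin n) ℝ |
        (∀ i, (v i).totalDegree ≤ k - 1) ∧
        ∀ (a : Fin n → ℝ) (B : Matrix (Fin n) (Fin n) ℝ), B.transpose = -B →
          ∫ y in convexHull ℝ (Set.range x),
            ∑ i, MvPolynomial.eval y (v i) * (a i + B.mulVec y i) = 0} := by
  set S := Submodule.span ℝ
    {M : Matrix (Fin n) (Fin n) (MvPolynomial (Fin n) ℝ) |
      ∃ (i j : Fin (n + 1)) (q : MvPolynomial (Fin n) ℝ), q.totalDegree ≤ k - 2 ∧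
        M = Matrix.of fun a b => lamp i * lamp j * q *
          C ((x j a - x i a) * (x j b - x i b))} with hS
  have hKc := isCompact_convexHull_range x
  have hKi := interior_convexHull_range_nonempty hx
  have hgreen := l2Form_matrixDiv_rankOneField hx hlam_deg hlam_bary hlam_sum
  have hrigid : ∀ (v : Fin n → MvPolynomial (Fin n) ℝ) (a : Fin n → ℝ)
      (B : Matrix (Fin n) (Fin n) ℝ), l2Form hKc v (affineField a B) =
        ∫ y in convexHull ℝ (Set.range x), ∑ i, eval y (v i) * (a i + B.mulVec y i) := by
    intro v a B
    change ∫ y in _, eval y (∑ i, v i * affineField a B i) = _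
    simp only [map_sum, map_mul, eval_affineField]
  have hsub : ∀ v ∈ S.map (matrixDiv n), (∀ i, (v i).totalDegree ≤ k - 1) ∧
      ∀ (a : Fin n → ℝ) (B : Matrix (Fin n) (Fin n) ℝ), B.transpose = -B →
        l2Form hKc v (affineField a B) = 0 := by
    intro v hv
    rw [hS, Submodule.map_span] at hv
    induction hv using Submodule.span_induction with
    | zero => simp
    | add u v _ _ hu hv =>
      refine ⟨fun i => (totalDegree_add _ _).trans (max_le (hu.1 i) (hv.1 i)), fun a B hB => ?_⟩
      rw [LinearMap.map_add₂, hu.2 a B hB, hv.2 a B hB, add_zero]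
    | smul c u _ hu =>
      refine ⟨fun i => (totalDegree_smul_le _ _).trans (hu.1 i), fun a B hB => ?_⟩
      rw [LinearMap.map_smul₂, hu.2 a B hB, smul_zero]
    | mem v hv =>
      obtain ⟨_, ⟨i, j, q, hq, rfl⟩, rfl⟩ := hv
      change (∀ a,
        (matrixDiv n (rankOneField (lamp i * lamp j * q) (x j - x i)) a).totalDegree ≤ _) ∧
        ∀ a B, _ → l2Form hKc (matrixDiv n (rankOneField (lamp i * lamp j * q) (x j - x i))) _ = 0
      refine ⟨fun a => ?_, fun a B hB => ?_⟩
      · rw [matrixDiv_rankOneField]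
        have h₁ := totalDegree_mul (C ((x j - x i) a))
          (dirDeriv (x j - x i) (lamp i * lamp j * q))
        have h₂ := totalDegree_dirDeriv_le (x j - x i) (lamp i * lamp j * q)
        have h₃ := totalDegree_mul (lamp i * lamp j) q
        have h₄ := totalDegree_mul (lamp i) (lamp j)
        have h₅ := hlam_deg i
        have h₆ := hlam_deg j
        rw [totalDegree_C] at h₁
        omega
      · rw [hgreen, strainAlong_affineField _ _ hB, mul_zero, map_zero, neg_zero]
  apply Set.Subset.antisymm
  · rintro _ ⟨M, hM, rfl⟩
    obtain ⟨h₁, h₂⟩ := hsub _ (Submodule.mem_map_of_mem hM)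
    exact ⟨h₁, fun a B hB => (hrigid _ a B).symm.trans (h₂ a B hB)⟩
  · rintro v ⟨hdeg, hv⟩
    have hfin := finiteDimensional_of_totalDegree_le fun v hv => (hsub v hv).1
    obtain ⟨w, hw, hort⟩ := exists_mem_forall_sub_orthogonal (l2Form hKc) (S.map (matrixDiv n))
      (fun w _ => eq_zero_of_l2Form_self_eq_zero hKc hKi) v
    have hudeg : ∀ i, ((v - w) i).totalDegree ≤ k - 1 := fun i =>
      (totalDegree_sub _ _).trans (max_le (hdeg i) ((hsub w hw).1 i))
    have hstrain : ∀ i j, strainAlong (x j - x i) (v - w) = 0 := by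
      intro i j
      set q := strainAlong (x j - x i) (v - w) with hq
      have hqdeg : q.totalDegree ≤ k - 2 := totalDegree_strainAlong_le _ hudeg
      have hmem : matrixDiv n (rankOneField (lamp i * lamp j * q) (x j - x i)) ∈
          S.map (matrixDiv n) :=
        Submodule.mem_map_of_mem (Submodule.subset_span ⟨i, j, q, hqdeg, rfl⟩)
      have h0 := hort _ hmem
      rw [l2Form_comm, hgreen, ← hq, neg_eq_zero] at h0
      have hp := eq_zero_of_integralOn_eq_zero hKc hKi (fun y hy => ?_) h0
      · have hne : ∀ l, lamp l ≠ 0 := fun l hl => by simpa [hl] using hlam_bary l l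
        simpa [hne] using hp
      · rw [convexHull_eq_setOf_eval_nonneg hx hlam_deg hlam_bary hlam_sum] at hy
        simp only [map_mul, mul_assoc]
        exact mul_nonneg (hy i) (mul_nonneg (hy j) (mul_self_nonneg _))
    obtain ⟨a, B, hB, hu⟩ := exists_rigid_of_symm_grad_eq_zero
      (symm_grad_eq_zero_of_strainAlong_edges hx hstrain)
    have hu' : v - w = affineField a B := _root_.funext hu
    have hself : l2Form hKc (v - w) (v - w) = 0 := by
      nth_rewrite 2 [hu']
      rw [LinearMap.map_sub₂, hrigid, hv a B hB, (hsub w hw).2 a B hB, sub_zero]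
    rw [sub_eq_zero.1 (eq_zero_of_l2Form_self_eq_zero hKc hKi hself)]
    exact hw
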